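/- Let Λ = Λ(p,e) ⊆ ℝ^n be the hyperbolicity cone of a complete isometric hyperbolic polynomial p of degree d along e. Then for every x ∈ ℝ^n, dist_p(x, Λ) = inf{‖λ(x) − u‖_2 : u ∈ λ(Λ)}, where dist_p is computed in the norm ‖·‖_p. In particular, if λ(Λ) = ℝ^d_+ ∩ ℝ^d_↓, then dist_p(x, Λ)^2 = Σ_{i=1}^d min(λ_i(x), 0)^2. -/

import Mathlib

theorem hyp_hom_eval {R : Type*} [CommRing R] {n N : ℕ} {Q : MvPolynomial (Fin n) R}
    (hQ : Q.IsHomogeneous N) (c : R) (x : Fin n → R) :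
    MvPolynomial.eval (c • x) Q = c ^ N * MvPolynomial.eval x Q := by
  rw [MvPolynomial.eval_eq, MvPolynomial.eval_eq, Finset.mul_sum]
  refine Finset.sum_congr rfl fun m hm => ?_
  have h := hQ.degree_eq_sum_deg_support hm
  have h2 : ∏ i ∈ m.support, c ^ m i = c ^ N := by
    rw [Finset.prod_pow_eq_pow_sum, h]
  simp only [Pi.smul_apply, smul_eq_mul, mul_pow, Finset.prod_mul_distrib, h2]
  ring

theorem hyp_line {R : Type*} [CommRing R] {n N : ℕ} {Q : MvPolynomial (Fin n) R}
    (hQ : Q.IsHomogeneous N) (x y : Fin n → R) :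
    ∃ r : Polynomial R, r.natDegree ≤ N ∧
      ∀ s, r.eval s = MvPolynomial.eval (x + s • y) Q := by
  refine ⟨MvPolynomial.aeval (fun i => Polynomial.C (x i) + Polynomial.C (y i) * Polynomial.X) Q,
    ?_, fun s => ?_⟩
  · have := MvPolynomial.aeval_natDegree_le (m := N) (n := 1) Q hQ.totalDegree_le
      (fun i => Polynomial.C (x i) + Polynomial.C (y i) * Polynomial.X) (fun i => by
        compute_degree)
    simpa using this
  · rw [MvPolynomial.aeval_def, ← Polynomial.coe_evalRingHom, MvPolynomial.hom_eval₂]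
    rw [MvPolynomial.eval, MvPolynomial.coe_eval₂Hom]
    congr 1
    · ext a; simp
    · ext i; simp; ring

open Polynomial in
theorem hyp_symm {d : ℕ} {W : MvPolynomial (Fin d) ℝ} (hW : W.IsSymmetric) :
    ∃ G : MvPolynomial (Fin d) ℝ, ∀ u : Fin d → ℝ, MvPolynomial.eval u W =
      MvPolynomial.eval (fun i : Fin d => (∏ j, (X + C (u j))).coeff (d - (i + 1))) G := by
  obtain ⟨G, hG⟩ := MvPolynomial.esymmAlgHom_surjective (σ := Fin d) ℝ (n := d) (by simp) ⟨W, hW⟩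
  refine ⟨G, fun u => ?_⟩
  have h1 := MvPolynomial.esymmAlgHom_apply (σ := Fin d) (R := ℝ) (n := d) G
  rw [hG] at h1
  simp only at h1
  rw [h1, MvPolynomial.aeval_def, MvPolynomial.hom_eval₂]
  change _ = MvPolynomial.eval₂ (RingHom.id ℝ) _ G
  congr 1
  · ext a; simp
  · ext i
    rw [Finset.prod_X_add_C_coeff _ _ (by simp)]
    have : d - (d - ((i:ℕ) + 1)) = i + 1 := by omega
    simp only [Finset.card_univ, Fintype.card_fin, this]
    simp [MvPolynomial.esymm]

theorem hyp_component {n N : ℕ} (q : MvPolynomial (Fin n) ℝ)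
    (h : ∀ (c : ℝ) x, c ≠ 0 → MvPolynomial.eval (c • x) q = c ^ N * MvPolynomial.eval x q) :
    q.IsHomogeneous N := by
  have key : MvPolynomial.homogeneousComponent N q = q := by
    apply MvPolynomial.funext
    intro x
    set M := q.totalDegree + N + 1
    let r : Polynomial ℝ := ∑ k ∈ Finset.range M,
      Polynomial.C (MvPolynomial.eval x (MvPolynomial.homogeneousComponent k q)) * Polynomial.X ^ k
    have hr : ∀ c, r.eval c = MvPolynomial.eval (c • x) q := by
      intro c
      have : q = ∑ k ∈ Finset.range M, MvPolynomial.homogeneousComponent k q := by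
        conv_lhs => rw [← MvPolynomial.sum_homogeneousComponent q]
        apply Finset.sum_subset
        · intro k; simp only [Finset.mem_range, M]; omega
        · intro k _ hk
          apply MvPolynomial.homogeneousComponent_eq_zero
          simp only [Finset.mem_range] at hk; omega
      conv_rhs => rw [this]
      rw [map_sum, Polynomial.eval_finsetSum]
      refine Finset.sum_congr rfl fun k _ => ?_
      rw [hyp_hom_eval (MvPolynomial.homogeneousComponent_isHomogeneous k q)]
      simp; ring
    have he : r = Polynomial.C (MvPolynomial.eval x q) * Polynomial.X ^ N := by
      apply Polynomial.eq_of_infinite_eval_eq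
      apply Set.Infinite.mono (s := {c | c ≠ 0})
      · intro c hc
        simp only [Set.mem_ofPred_eq] at hc ⊢
        rw [hr, h c x hc]; simp; ring
      · exact (Set.finite_singleton (0:ℝ)).infinite_compl
    have := congrArg (fun p => p.coeff N) he
    simp only [r, Polynomial.finsetSum_coeff, Polynomial.coeff_C_mul_X_pow] at this
    rw [Finset.sum_ite_eq] at this
    simpa [M] using this
  rw [← key]
  exact MvPolynomial.homogeneousComponent_isHomogeneous N q

open Polynomial in
theorem hyp_lift {n d : ℕ}
    (P : MvPolynomial (Fin n) ℝ) (e : Fin n → ℝ)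
    (lm : (Fin n → ℝ) → Fin d → ℝ)
    (hhom : P.IsHomogeneous d)
    (hpe : MvPolynomial.eval e P ≠ 0)
    (hroots : ∀ (x : Fin n → ℝ) (t : ℝ),
      MvPolynomial.eval (x - t • e) P = MvPolynomial.eval e P * ∏ i, (lm x i - t))
    {N : ℕ} {W : MvPolynomial (Fin d) ℝ} (hW : W.IsSymmetric) (hN : W.IsHomogeneous N) :
    ∃ Q : MvPolynomial (Fin n) ℝ, Q.IsHomogeneous N ∧
      (∀ x, MvPolynomial.eval x Q = MvPolynomial.eval (lm x) W) ∧
      ∀ x t, MvPolynomial.eval (x + t • e) Q = MvPolynomial.eval (fun i => lm x i + t) W := by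
  obtain ⟨G, hG⟩ := hyp_symm hW
  have hr : ∀ x (t : ℝ), MvPolynomial.eval (x + t • e) P
      = MvPolynomial.eval e P * ∏ i, (t + lm x i) := by
    intro x t
    have := hroots x (-t)
    simp only [neg_smul, sub_neg_eq_add] at this
    rw [this]; congr 1; exact Finset.prod_congr rfl fun i _ => add_comm _ _
  have hsym : ∀ u v : Fin d → ℝ, (∀ s, ∏ i, (s + u i) = ∏ i, (s + v i)) →
      MvPolynomial.eval u W = MvPolynomial.eval v W := by
    intro u v h
    have : (∏ j, (X + C (u j)) : ℝ[X]) = ∏ j, (X + C (v j)) := by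
      apply Polynomial.funext; intro s; simpa [Polynomial.eval_prod] using h s
    rw [hG, hG, this]
  let Pg : Polynomial (MvPolynomial (Fin n) ℝ) :=
    MvPolynomial.aeval (fun i => C (MvPolynomial.X i) + C (MvPolynomial.C (e i)) * X) P
  have hPg : ∀ x, Pg.map (MvPolynomial.eval x) = C (MvPolynomial.eval e P) * ∏ j, (X + C (lm x j)) := by
    intro x
    apply Polynomial.funext
    intro t
    have h1 := hr x t
    simp only [Polynomial.eval_mul, Polynomial.eval_C, Polynomial.eval_prod, Polynomial.eval_add,
      Polynomial.eval_X]
    rw [← h1, ← Polynomial.coe_evalRingHom, ← Polynomial.coe_mapRingHom]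
    simp only [Pg]
    rw [MvPolynomial.aeval_def, MvPolynomial.hom_eval₂, MvPolynomial.hom_eval₂]
    change _ = MvPolynomial.eval₂ (RingHom.id ℝ) _ P
    congr 1
    · ext a; simp
    · ext i; simp; ring
  let Q : MvPolynomial (Fin n) ℝ := MvPolynomial.aeval
    (fun i : Fin d => MvPolynomial.C ((MvPolynomial.eval e P)⁻¹) * Pg.coeff (d - (i+1))) G
  have hQ : ∀ x, MvPolynomial.eval x Q = MvPolynomial.eval (lm x) W := by
    intro x
    rw [hG]
    simp only [Q]
    rw [MvPolynomial.aeval_def, MvPolynomial.hom_eval₂]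
    change _ = MvPolynomial.eval₂ (RingHom.id ℝ) _ G
    congr 1
    · ext a; simp
    · ext i
      have := congrArg (fun p => p.coeff (d - ((i:ℕ)+1))) (hPg x)
      simp only [Polynomial.coeff_map, Polynomial.coeff_C_mul] at this
      change MvPolynomial.eval x _ = _
      rw [map_mul, this, MvPolynomial.eval_C]
      field_simp
  refine ⟨Q, ?_, hQ, ?_⟩
  · apply hyp_component
    intro c x hc
    rw [hQ, hQ, ← hyp_hom_eval hN]
    apply hsym
    intro s
    have h1 := hr (c • x) s
    have h2 : c • x + s • e = c • (x + (c⁻¹ * s) • e) := by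
      rw [smul_add, smul_smul]; congr 2; field_simp
    rw [h2, hyp_hom_eval hhom, hr] at h1
    have h3 : ∏ i, (s + lm (c • x) i) = c ^ d * ∏ i, (c⁻¹ * s + lm x i) := by
      apply mul_left_cancel₀ hpe; rw [← h1]; ring
    rw [h3]
    have : c ^ d = ∏ _i : Fin d, c := by simp
    rw [this, ← Finset.prod_mul_distrib]
    refine Finset.prod_congr rfl fun i _ => ?_
    simp; field_simp
  · intro x t
    rw [hQ]
    apply hsym
    intro s
    have h1 := hr (x + t • e) s
    have h2 : x + t • e + s • e = x + (s + t) • e := by rw [add_smul]; abel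
    rw [h2, hr] at h1
    rw [← mul_left_cancel₀ hpe h1]
    exact Finset.prod_congr rfl fun i _ => by ring

theorem hyp_lower {N : ℕ} (r : Polynomial ℂ) (hr : r.natDegree ≤ N) (z0 : ℂ) (κ : ℝ)
    (hκ0 : 0 ≤ κ) (hκ1 : κ ≤ 1)
    (h : ∀ z, r.IsRoot z → κ * ‖z‖ ≤ ‖z0 - z‖) :
    κ ^ N * ‖r.eval 0‖ ≤ ‖r.eval z0‖ := by
  by_cases hr0 : r = 0
  · simp [hr0]
  have hsp := (IsAlgClosed.splits r).eq_prod_roots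
  have hev : ∀ z, ‖r.eval z‖ = ‖r.leadingCoeff‖ * (r.roots.map fun a => ‖z - a‖).prod := by
    intro z
    conv_lhs => rw [hsp]
    rw [Polynomial.eval_mul, Polynomial.eval_C, norm_mul, Polynomial.eval_multiset_prod,
      Multiset.map_map]
    congr 1
    have := map_multiset_prod (normHom : ℂ →*₀ ℝ)
      (r.roots.map ((Polynomial.eval z) ∘ fun a => Polynomial.X - Polynomial.C a))
    simp only [normHom, MonoidWithZeroHom.coe_mk, ZeroHom.coe_mk, Multiset.map_map] at this
    rw [this]
    congr 1
    apply Multiset.map_congr rfl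
    intro a _; simp
  rw [hev, hev]
  have hcard : r.roots.card ≤ N := (Polynomial.card_roots' r).trans hr
  have h2 : (r.roots.map fun a => κ * ‖0 - a‖).prod ≤ (r.roots.map fun a => ‖z0 - a‖).prod := by
    apply Multiset.prod_map_le_prod_map₀
    · intro a _; positivity
    · intro a ha
      simpa using h a (Polynomial.isRoot_of_mem_roots ha)
  rw [Multiset.prod_map_mul, Multiset.map_const', Multiset.prod_replicate] at h2
  have h3 : κ ^ N ≤ κ ^ r.roots.card := pow_le_pow_of_le_one hκ0 hκ1 hcard
  have h4 : 0 ≤ (r.roots.map fun a => ‖0 - a‖).prod := by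
    apply Multiset.prod_nonneg
    intro a ha
    obtain ⟨b, _, rfl⟩ := Multiset.mem_map.1 ha
    positivity
  have h5 := (mul_le_mul_of_nonneg_right h3 h4).trans h2
  have := mul_le_mul_of_nonneg_left h5 (norm_nonneg r.leadingCoeff)
  linarith

theorem hyp_homotopy {n N : ℕ} {Q : MvPolynomial (Fin n) ℂ} (hQ : Q.IsHomogeneous N)
    (b y c : Fin n → ℂ) (hc : MvPolynomial.eval c Q ≠ 0)
    (hbd : ∀ ρ : ℝ, 0 ≤ ρ → ρ ≤ 1 → ∀ s : ℂ, s.re = 0 →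
      MvPolynomial.eval (b + (ρ : ℂ) • y + s • c) Q ≠ 0)
    (h0 : ∀ s : ℂ, 0 ≤ s.re → MvPolynomial.eval (b + s • c) Q ≠ 0) :
    ∀ s : ℂ, 0 ≤ s.re → MvPolynomial.eval (b + y + s • c) Q ≠ 0 := by
  let F : unitInterval × ℂ → ℂ := fun p => MvPolynomial.eval (b + ((p.1 : ℝ) : ℂ) • y + p.2 • c) Q
  have hF : Continuous F := by
    refine (MvPolynomial.continuous_eval Q).comp ?_
    fun_prop
  have hinv : ∀ (ρ : unitInterval) (s : ℂ), s ≠ 0 →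
      F (ρ, s) = s ^ N * MvPolynomial.eval (c + s⁻¹ • (b + ((ρ : ℝ) : ℂ) • y)) Q := by
    intro ρ s hs
    rw [← hyp_hom_eval hQ]
    simp only [F]
    congr 2
    rw [smul_add, smul_smul, mul_inv_cancel₀ hs, one_smul]
    abel
  obtain ⟨R, hR⟩ : ∃ R : ℝ, ∀ (ρ : unitInterval) (s : ℂ), F (ρ, s) = 0 → ‖s‖ ≤ R := by
    have hcont := (MvPolynomial.continuous_eval Q).continuousAt (x := c)
    obtain ⟨ε, hε, hball⟩ := Metric.eventually_nhds_iff.1 (hcont.eventually_ne hc)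
    refine ⟨(‖b‖ + ‖y‖) / ε, fun ρ s hs => ?_⟩
    by_contra hlt
    push Not at hlt
    have hsn : 0 < ‖s‖ := lt_of_le_of_lt (by positivity) hlt
    have hs0 : s ≠ 0 := norm_pos_iff.1 hsn
    rw [hinv ρ s hs0] at hs
    refine hball ?_ ((mul_eq_zero.1 hs).resolve_left (pow_ne_zero _ hs0))
    rw [dist_eq_norm, add_sub_cancel_left, norm_smul, norm_inv]
    have h1 : ‖b + ((ρ : ℝ) : ℂ) • y‖ ≤ ‖b‖ + ‖y‖ := by
      refine (norm_add_le _ _).trans ?_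
      rw [norm_smul, Complex.norm_real, Real.norm_of_nonneg ρ.2.1]
      have := mul_le_mul_of_nonneg_right ρ.2.2 (norm_nonneg y)
      linarith
    rw [div_lt_iff₀ hε] at hlt
    rw [inv_mul_lt_iff₀ hsn]
    linarith
  let A : Set unitInterval := {ρ | ∃ s : ℂ, 0 ≤ s.re ∧ F (ρ, s) = 0}
  have hclosed : IsClosed A := by
    have hK : IsCompact (({p | 0 ≤ p.2.re ∧ F p = 0} : Set (unitInterval × ℂ)) ∩
        (Set.univ ×ˢ Metric.closedBall (0:ℂ) R)) := by
      apply IsCompact.inter_left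
      · exact isCompact_univ.prod (isCompact_closedBall _ _)
      · apply IsClosed.inter
        · exact isClosed_le continuous_const (Complex.continuous_re.comp continuous_snd)
        · exact isClosed_eq hF continuous_const
    have : A = Prod.fst '' (({p | 0 ≤ p.2.re ∧ F p = 0} : Set (unitInterval × ℂ)) ∩
        (Set.univ ×ˢ Metric.closedBall (0:ℂ) R)) := by
      ext ρ
      constructor
      · rintro ⟨s, hs, hs2⟩
        exact ⟨(ρ, s), ⟨⟨hs, hs2⟩, ⟨trivial, by simpa using hR ρ s hs2⟩⟩, rfl⟩
      · rintro ⟨⟨ρ', s⟩, ⟨⟨hs, hs2⟩, _⟩, rfl⟩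
        exact ⟨s, hs, hs2⟩
    rw [this]
    exact (hK.image continuous_fst).isClosed
  have hopen : IsOpen A := by
    rw [isOpen_iff_mem_nhds]
    rintro ρ0 ⟨s0, hs0, hs0F⟩
    have hpos : 0 < s0.re := by
      rcases hs0.lt_or_eq with h | h
      · exact h
      · exact absurd hs0F (hbd ρ0 ρ0.2.1 ρ0.2.2 s0 h.symm)
    have hs0ne : s0 ≠ 0 := by rintro rfl; simp at hpos
    have hzpos : 0 < (s0⁻¹).re := by
      rw [Complex.inv_re]; exact div_pos hpos (Complex.normSq_pos.2 hs0ne)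
    set z0 := s0⁻¹ with hz0
    set κ := z0.re / (z0.re + ‖z0‖) with hκ
    have hκ0 : 0 < κ := by positivity
    have hκ1 : κ ≤ 1 := by
      rw [hκ, div_le_one (by positivity)]; linarith [norm_nonneg z0]
    have hcontρ : ContinuousAt (fun ρ => ‖F (ρ, s0)‖) ρ0 := by
      apply Continuous.continuousAt; fun_prop
    have hlim : ∀ᶠ ρ in nhds ρ0, ‖F (ρ, s0)‖ < ‖s0‖ ^ N * (κ ^ N * ‖MvPolynomial.eval c Q‖) := by
      apply hcontρ.eventually_lt continuousAt_const
      rw [hs0F, norm_zero]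
      have := norm_pos_iff.2 hc
      have := norm_pos_iff.2 hs0ne
      positivity
    filter_upwards [hlim] with ρ hρ
    by_contra hnot
    obtain ⟨r, hrd, hr⟩ := hyp_line hQ c (b + ((ρ : ℝ) : ℂ) • y)
    have hlow := hyp_lower r hrd z0 κ hκ0.le hκ1 (by
      intro z hz
      have hzr : r.eval z = 0 := hz
      by_cases hz00 : z = 0
      · subst hz00; simp
      have hre : z.re < 0 := by
        by_contra hge
        push Not at hge
        apply hnot
        refine ⟨z⁻¹, ?_, ?_⟩
        · rw [Complex.inv_re]; exact div_nonneg hge (Complex.normSq_nonneg _)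
        · rw [hinv ρ _ (inv_ne_zero hz00), inv_inv, ← hr, hzr, mul_zero]
      have h1 : z0.re ≤ ‖z0 - z‖ := by
        have := Complex.re_le_norm (z0 - z)
        rw [Complex.sub_re] at this
        linarith
      have h2 : ‖z‖ ≤ ‖z0 - z‖ + ‖z0‖ := by
        have := norm_sub_le z0 (z0 - z)
        rw [sub_sub_cancel] at this; linarith
      rw [hκ, div_mul_eq_mul_div, div_le_iff₀ (by positivity)]
      nlinarith [norm_nonneg z0, norm_nonneg z])
    rw [hr, hr, zero_smul, add_zero] at hlow
    rw [hinv ρ s0 hs0ne, norm_mul, norm_pow] at hρ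
    have := norm_pos_iff.2 hs0ne
    have := lt_of_mul_lt_mul_left hρ (by positivity)
    linarith
  rcases isClopen_iff.1 ⟨hclosed, hopen⟩ with h | h
  · intro s hs hs2
    have : (1 : unitInterval) ∈ A := ⟨s, hs, by simpa [F] using hs2⟩
    rw [h] at this; exact this
  · exfalso
    have : (0 : unitInterval) ∈ A := by rw [h]; trivial
    obtain ⟨s, hs, hs2⟩ := this
    exact h0 s hs (by simpa [F] using hs2)

noncomputable def hypC {n : ℕ} (x : Fin n → ℝ) : Fin n → ℂ := fun i => (x i : ℂ)

theorem hypC_add {n : ℕ} (x y : Fin n → ℝ) : hypC (x + y) = hypC x + hypC y := by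
  ext i; simp [hypC]

theorem hypC_smul {n : ℕ} (c : ℝ) (x : Fin n → ℝ) : hypC (c • x) = (c : ℂ) • hypC x := by
  ext i; simp [hypC]

theorem hyp_garding {n N : ℕ} {Q : MvPolynomial (Fin n) ℂ} (hQ : Q.IsHomogeneous N)
    (e : Fin n → ℝ) (he : MvPolynomial.eval (hypC e) Q ≠ 0)
    (h1 : ∀ (x : Fin n → ℝ) (z : ℂ), MvPolynomial.eval (hypC x + z • hypC e) Q = 0 → z.im = 0)
    (a y : Fin n → ℝ)
    (ha : ∀ t : ℝ, 0 ≤ t → MvPolynomial.eval (hypC (a + t • e)) Q ≠ 0)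
    (hy : ∀ t : ℝ, 0 ≤ t → MvPolynomial.eval (hypC (y + t • e)) Q ≠ 0)
    (δ : ℝ) (hδ : 0 < δ) : MvPolynomial.eval (hypC (y + (a + δ • e))) Q ≠ 0 := by
  have ha' : ∀ z : ℂ, MvPolynomial.eval (hypC a + z • hypC e) Q = 0 → ∃ t : ℝ, t < 0 ∧ z = t := by
    intro z hz
    have him := h1 a z hz
    have hz' : z = (z.re : ℂ) := by
      apply Complex.ext <;> simp [him]
    refine ⟨z.re, ?_, hz'⟩
    by_contra hge
    push Not at hge
    apply ha z.re hge
    rw [hypC_add, hypC_smul, ← hz', hz]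
  have hdiv : ∀ (v : Fin n → ℂ) (c : ℂ), c ≠ 0 → MvPolynomial.eval v Q = 0 →
      MvPolynomial.eval (c • v) Q = 0 := by
    intro v c _ h
    rw [hyp_hom_eval hQ, h, mul_zero]
  have ha0 : MvPolynomial.eval (hypC a) Q ≠ 0 := by simpa using ha 0 le_rfl
  have claim1 : ∀ (x : Fin n → ℝ) (s : ℂ), 0 ≤ s.re →
      MvPolynomial.eval (Complex.I • hypC e + hypC x + s • Complex.I • hypC a) Q ≠ 0 := by
    intro x
    apply hyp_homotopy hQ
    · rw [hyp_hom_eval hQ]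
      exact mul_ne_zero (pow_ne_zero _ Complex.I_ne_zero) ha0
    · intro ρ _ _ s hs h
      have hs' : s * Complex.I = ((-s.im : ℝ) : ℂ) := by
        apply Complex.ext <;> simp [hs]
      have := h1 (ρ • x + (-s.im) • a) Complex.I (by
        rw [hypC_add, hypC_smul, hypC_smul, ← h, smul_smul, hs']
        congr 2; abel)
      simp at this
    · intro s hs h
      by_cases hs0 : s = 0
      · rw [hs0, zero_smul, add_zero, hyp_hom_eval hQ] at h
        exact mul_ne_zero (pow_ne_zero _ Complex.I_ne_zero) he h
      have hc : s * Complex.I ≠ 0 := mul_ne_zero hs0 Complex.I_ne_zero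
      have h2 := hdiv _ _ (inv_ne_zero hc) h
      rw [smul_add, smul_smul, smul_smul, smul_smul, mul_assoc _ s, inv_mul_cancel₀ hc, one_smul,
        add_comm] at h2
      obtain ⟨t, ht, hts⟩ := ha' _ h2
      have : (s⁻¹ : ℂ) = t := by
        rw [← hts]; field_simp
      have h3 : s = ((t⁻¹ : ℝ) : ℂ) := by rw [Complex.ofReal_inv, ← this, inv_inv]
      rw [h3, Complex.ofReal_re] at hs
      have := inv_lt_zero.2 ht
      linarith
  have claim1' : ∀ (x : Fin n → ℝ) (v : ℝ), v ≠ 0 →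
      MvPolynomial.eval (hypC x + ((v : ℂ) * Complex.I) • hypC (a + δ • e)) Q ≠ 0 := by
    intro x v hv h
    have hc : ((v * δ : ℝ) : ℂ) ≠ 0 := by
      exact_mod_cast mul_ne_zero hv hδ.ne'
    have h2 := hdiv _ _ (inv_ne_zero hc) h
    apply claim1 ((v * δ)⁻¹ • x) ((δ⁻¹ : ℝ) : ℂ) (by rw [Complex.ofReal_re]; positivity)
    rw [← h2]
    congr 2
    have hv' : (v : ℂ) ≠ 0 := by exact_mod_cast hv
    have hδ' : (δ : ℂ) ≠ 0 := by exact_mod_cast hδ.ne'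
    ext i
    simp [hypC]
    field_simp
    ring
  have hfin := hyp_homotopy hQ (hypC e) (hypC (y - e)) (hypC (a + δ • e)) (ha δ hδ.le) (by
      intro ρ hρ0 hρ1 s hs h
      have hs' : s = (s.im : ℂ) * Complex.I := by
        apply Complex.ext <;> simp [hs]
      by_cases hv : s.im = 0
      · rw [hs', hv] at h
        simp only [Complex.ofReal_zero, zero_mul, zero_smul, add_zero] at h
        by_cases hρ : ρ = 0
        · rw [hρ] at h; simp at h; exact he h
        · have hρp : 0 < ρ := lt_of_le_of_ne hρ0 (Ne.symm hρ)
          have hc : (ρ : ℂ) ≠ 0 := by exact_mod_cast hρ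
          have h2 := hdiv _ _ (inv_ne_zero hc) h
          apply hy ((1 - ρ) / ρ) (div_nonneg (by linarith) hρ0)
          rw [← h2]
          congr 2
          ext i
          simp [hypC]
          field_simp
          ring
      · apply claim1' (e + ρ • (y - e)) s.im hv
        rw [← hs', hypC_add, hypC_smul, h]) (by
      intro s hs h
      by_cases hs0 : s = 0
      · rw [hs0, zero_smul, add_zero] at h; exact he h
      have h2 := hdiv _ _ (inv_ne_zero hs0) h
      obtain ⟨t, ht, hts⟩ := ha' (s⁻¹ + δ) (by
        rw [← h2]
        congr 2
        ext i
        simp [hypC]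
        field_simp
        ring)
      have h3 : s⁻¹ = ((t - δ : ℝ) : ℂ) := by
        rw [Complex.ofReal_sub, ← hts]; ring
      have h4 : s = (((t - δ)⁻¹ : ℝ) : ℂ) := by rw [Complex.ofReal_inv, ← h3, inv_inv]
      rw [h4, Complex.ofReal_re] at hs
      have := inv_lt_zero.2 (show t - δ < 0 by linarith)
      linarith) 1 (by simp)
  have hv : hypC (y + (a + δ • e)) = hypC e + hypC (y - e) + (1 : ℂ) • hypC (a + δ • e) := by
    rw [one_smul, ← hypC_add, ← hypC_add]
    congr 1
    abel
  rw [hv]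
  exact hfin

theorem hyp_deg1 {n : ℕ} {Q : MvPolynomial (Fin n) ℝ} (hQ : Q.IsHomogeneous 1)
    (x y : Fin n → ℝ) :
    MvPolynomial.eval (x + y) Q = MvPolynomial.eval x Q + MvPolynomial.eval y Q := by
  obtain ⟨r, hrd, hr⟩ := hyp_line hQ x y
  have hev : ∀ s, MvPolynomial.eval (x + s • y) Q = r.coeff 0 + r.coeff 1 * s := by
    intro s
    rw [← hr, Polynomial.eval_eq_sum_range' (n := 2) (by omega)]
    simp [Finset.sum_range_succ]
  obtain ⟨r', hrd', hr'⟩ := hyp_line hQ y x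
  have hev' : ∀ s, MvPolynomial.eval (y + s • x) Q = r'.coeff 0 + r'.coeff 1 * s := by
    intro s
    rw [← hr', Polynomial.eval_eq_sum_range' (n := 2) (by omega)]
    simp [Finset.sum_range_succ]
  have e0 := hev 0
  have e0' := hev' 0
  have e1 := hev 1
  have e1' := hev' 1
  have e2 := hev 2
  have e2' := hev' (1/2)
  have h2 : x + (2:ℝ) • y = (2:ℝ) • (y + (1/2:ℝ) • x) := by
    rw [smul_add, smul_smul]; norm_num; abel
  rw [h2, hyp_hom_eval hQ, e2'] at e2
  rw [one_smul] at e1 e1'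
  rw [add_comm y x] at e1'
  simp only [zero_smul, add_zero, mul_zero] at e0 e0'
  linarith

theorem hyp_deg2 {n : ℕ} {Q : MvPolynomial (Fin n) ℝ} (hQ : Q.IsHomogeneous 2)
    (x y : Fin n → ℝ) :
    MvPolynomial.eval (x - y) Q = 2 * MvPolynomial.eval x Q + 2 * MvPolynomial.eval y Q
      - MvPolynomial.eval (x + y) Q := by
  obtain ⟨r, hrd, hr⟩ := hyp_line hQ x y
  have hev : ∀ s, MvPolynomial.eval (x + s • y) Q
      = r.coeff 0 + r.coeff 1 * s + r.coeff 2 * s ^ 2 := by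
    intro s
    rw [← hr, Polynomial.eval_eq_sum_range' (n := 3) (by omega)]
    simp [Finset.sum_range_succ]
  obtain ⟨r', hrd', hr'⟩ := hyp_line hQ y x
  have hev' : ∀ s, MvPolynomial.eval (y + s • x) Q
      = r'.coeff 0 + r'.coeff 1 * s + r'.coeff 2 * s ^ 2 := by
    intro s
    rw [← hr', Polynomial.eval_eq_sum_range' (n := 3) (by omega)]
    simp [Finset.sum_range_succ]
  have e0 := hev 0
  have e0' := hev' 0
  have e1 := hev 1
  have e1' := hev' 1
  have em := hev (-1)
  have em' := hev' (-1)
  have e2 := hev 2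
  have e2' := hev' (1/2)
  have h2 : x + (2:ℝ) • y = (2:ℝ) • (y + (1/2:ℝ) • x) := by
    rw [smul_add, smul_smul]; norm_num; abel
  have hm : y + (-1:ℝ) • x = (-1:ℝ) • (x + (-1:ℝ) • y) := by
    rw [smul_add, smul_smul]; norm_num; abel
  rw [h2, hyp_hom_eval hQ, e2'] at e2
  rw [hm, hyp_hom_eval hQ] at em'
  have hs : x + (-1:ℝ) • y = x - y := by rw [neg_one_smul, sub_eq_add_neg]
  rw [hs] at em em'
  rw [one_smul] at e1 e1'
  rw [add_comm y x] at e1'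
  simp only [zero_smul, add_zero, mul_zero] at e0 e0'
  norm_num at e0 e0' e1 e1' e2 em em'
  linarith

theorem hyp_eval_map {n : ℕ} (Q : MvPolynomial (Fin n) ℝ) (x : Fin n → ℝ) :
    MvPolynomial.eval (hypC x) (MvPolynomial.map Complex.ofRealHom Q)
      = ((MvPolynomial.eval x Q : ℝ) : ℂ) := by
  have h := MvPolynomial.map_eval Complex.ofRealHom x Q
  have h2 : hypC x = Complex.ofRealHom ∘ x := by ext i; simp [hypC]
  rw [h2, ← h]; rfl

theorem hyp_subadd {n d : ℕ}
    (P : MvPolynomial (Fin n) ℝ) (e : Fin n → ℝ)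
    (lm : (Fin n → ℝ) → Fin d → ℝ)
    (hhom : P.IsHomogeneous d)
    (hpe : MvPolynomial.eval e P ≠ 0)
    (hroots : ∀ (x : Fin n → ℝ) (t : ℝ),
      MvPolynomial.eval (x - t • e) P = MvPolynomial.eval e P * ∏ i, (lm x i - t))
    (hord : ∀ x, Antitone (lm x)) (w : Fin d → ℝ) (hw : Antitone w) (hw1 : ∑ i, w i = 1)
    (x y : Fin n → ℝ) :
    ∑ i, w i * lm (x + y) i ≤ ∑ i, w i * lm x i + ∑ i, w i * lm y i := by
  let W : MvPolynomial (Fin d) ℝ :=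
    ∏ π : Equiv.Perm (Fin d), ∑ i, MvPolynomial.C (w (π i)) * MvPolynomial.X i
  have hWs : W.IsSymmetric := by
    intro σ
    simp only [W, map_prod, map_sum, map_mul, MvPolynomial.rename_C, MvPolynomial.rename_X]
    rw [← Equiv.prod_comp (Equiv.mulRight σ)]
    refine Finset.prod_congr rfl fun π _ => ?_
    rw [← Equiv.sum_comp σ (fun i => MvPolynomial.C (w (π i)) * MvPolynomial.X i)]
    rfl
  have hWh : W.IsHomogeneous (∑ _π : Equiv.Perm (Fin d), 1) := by
    apply MvPolynomial.IsHomogeneous.prod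
    intro π _
    apply MvPolynomial.IsHomogeneous.sum
    intro i _
    exact MvPolynomial.isHomogeneous_C_mul_X _ _
  generalize (∑ _π : Equiv.Perm (Fin d), 1) = N at hWh
  obtain ⟨Q, hQ, -, hQ2⟩ := hyp_lift P e lm hhom hpe hroots hWs hWh
  let m : (Fin n → ℝ) → Equiv.Perm (Fin d) → ℝ := fun x π => ∑ i, w (π i) * lm x i
  have hm : ∀ x (t : ℝ), MvPolynomial.eval (x + t • e) Q = ∏ π, (m x π + t) := by
    intro x t
    rw [hQ2]
    simp only [W, map_prod, map_sum, map_mul, MvPolynomial.eval_C, MvPolynomial.eval_X]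
    refine Finset.prod_congr rfl fun π _ => ?_
    simp only [m, mul_add, Finset.sum_add_distrib, ← Finset.sum_mul]
    rw [Equiv.sum_comp π w, hw1, one_mul]
  have hmax : ∀ x π, m x π ≤ m x 1 := by
    intro x π
    have hv : Monovary w (lm x) := hw.monovary (hord x)
    exact hv.sum_comp_perm_mul_le_sum_mul
  have hneg : ∀ x (t : ℝ), m x 1 < t → MvPolynomial.eval (t • e - x) Q ≠ 0 := by
    intro x t ht
    have : t • e - x = (-1 : ℝ) • (x + (-t) • e) := by
      rw [smul_add, smul_smul]; simp; abel
    rw [this, hyp_hom_eval hQ, hm]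
    refine mul_ne_zero (pow_ne_zero _ (by norm_num)) (Finset.prod_ne_zero_iff.2 fun π _ => ?_)
    have := hmax x π
    intro h; linarith
  have hQe : MvPolynomial.eval e Q ≠ 0 := by
    intro h
    have h2 := hneg 0 (m 0 1 + 1) (by linarith)
    rw [sub_zero, hyp_hom_eval hQ, h, mul_zero] at h2
    exact h2 rfl
  have hQC := hQ.map Complex.ofRealHom
  have hyper : ∀ (x : Fin n → ℝ) (z : ℂ),
      MvPolynomial.eval (hypC x + z • hypC e) (MvPolynomial.map Complex.ofRealHom Q) = 0 →
        z.im = 0 := by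
    intro x z hz
    obtain ⟨r, -, hr⟩ := hyp_line hQC (hypC x) (hypC e)
    have hreq : r = ∏ π, (Polynomial.C ((m x π : ℝ) : ℂ) + Polynomial.X) := by
      apply Polynomial.eq_of_infinite_eval_eq
      apply Set.Infinite.mono (s := Set.range (fun t : ℝ => (t : ℂ)))
      · rintro _ ⟨t, rfl⟩
        change r.eval (t : ℂ) = Polynomial.eval (t : ℂ) _
        rw [hr, ← hypC_smul, ← hypC_add, hyp_eval_map, hm, Polynomial.eval_prod]
        simp
      · exact Set.infinite_range_of_injective Complex.ofReal_injective
    rw [← hr, hreq, Polynomial.eval_prod] at hz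
    obtain ⟨π, _, hπ⟩ := Finset.prod_eq_zero_iff.1 hz
    simp only [Polynomial.eval_add, Polynomial.eval_C, Polynomial.eval_X] at hπ
    have := congrArg Complex.im hπ
    simpa using this
  by_contra hcon
  push Not at hcon
  have hcon' : m x 1 + m y 1 < m (x + y) 1 := hcon
  set ε := (m (x + y) 1 - m x 1 - m y 1) / 3 with hε
  have hεp : 0 < ε := by rw [hε]; linarith
  have key : ∀ v : Fin n → ℝ, ∀ t : ℝ, 0 ≤ t → MvPolynomial.eval
      (hypC (((m v 1 + ε) • e - v) + t • e)) (MvPolynomial.map Complex.ofRealHom Q) ≠ 0 := by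
    intro v t ht
    have : ((m v 1 + ε) • e - v) + t • e = (m v 1 + ε + t) • e - v := by
      rw [add_smul _ t]; abel
    rw [this, hyp_eval_map]
    exact_mod_cast hneg v _ (by linarith)
  have hfin := hyp_garding hQC e (by rw [hyp_eval_map]; exact_mod_cast hQe) hyper _ _
    (key x) (key y) ε hεp
  rw [hyp_eval_map] at hfin
  apply hfin
  have hv : (m y 1 + ε) • e - y + ((m x 1 + ε) • e - x + ε • e)
      = (-1 : ℝ) • ((x + y) + (-(m (x + y) 1)) • e) := by
    have h3 : m (x + y) 1 = m y 1 + ε + (m x 1 + ε) + ε := by rw [hε]; ring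
    rw [h3]
    ext i
    simp only [Pi.add_apply, Pi.sub_apply, Pi.smul_apply, smul_eq_mul]
    ring
  rw [hv, hyp_hom_eval hQ, hm, Finset.prod_eq_zero (Finset.mem_univ 1) (by ring)]
  simp

theorem hyp_norm {n d : ℕ}
    (P : MvPolynomial (Fin n) ℝ) (e : Fin n → ℝ)
    (lm : (Fin n → ℝ) → Fin d → ℝ)
    (hhom : P.IsHomogeneous d)
    (hpe : MvPolynomial.eval e P ≠ 0)
    (hroots : ∀ (x : Fin n → ℝ) (t : ℝ),
      MvPolynomial.eval (x - t • e) P = MvPolynomial.eval e P * ∏ i, (lm x i - t))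
    (hord : ∀ x, Antitone (lm x)) (x y : Fin n → ℝ) :
    ∑ i, lm (x + y) i ^ 2 ≤ ∑ i, (lm x i + lm y i) ^ 2 := by
  rcases Nat.eq_zero_or_pos d with hd | hd
  · subst hd; simp
  have htr : ∑ i, lm (x + y) i = ∑ i, lm x i + ∑ i, lm y i := by
    obtain ⟨Q, hQ, hQ1, -⟩ := hyp_lift P e lm hhom hpe hroots
      (MvPolynomial.psum_isSymmetric (Fin d) ℝ 1) (N := 1) (by
        apply MvPolynomial.IsHomogeneous.sum
        intro i _
        exact MvPolynomial.isHomogeneous_X_pow i 1)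
    have := hyp_deg1 hQ x y
    simpa [hQ1, MvPolynomial.psum] using this
  set c : ℝ := (1 - ∑ i, lm (x + y) i) / d with hc
  have hd' : (d : ℝ) ≠ 0 := by positivity
  have h := hyp_subadd P e lm hhom hpe hroots hord (fun i => lm (x + y) i + c)
    (fun i j hij => by have := hord (x + y) hij; simp only; linarith)
    (by rw [Finset.sum_add_distrib, Finset.sum_const, Finset.card_univ, Fintype.card_fin,
          nsmul_eq_mul, hc]; field_simp; ring) x y
  simp only [add_mul, Finset.sum_add_distrib, ← Finset.mul_sum] at h
  rw [htr] at h
  have h2 : 0 ≤ ∑ i, (lm (x + y) i - (lm x i + lm y i)) ^ 2 :=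
    Finset.sum_nonneg fun i _ => sq_nonneg _
  have h3 : ∑ i, (lm (x + y) i - (lm x i + lm y i)) ^ 2 = ∑ i, lm (x + y) i * lm (x + y) i
      - 2 * (∑ i, lm (x + y) i * lm x i + ∑ i, lm (x + y) i * lm y i)
      + ∑ i, (lm x i + lm y i) ^ 2 := by
    rw [← Finset.sum_add_distrib, Finset.mul_sum, ← Finset.sum_sub_distrib,
      ← Finset.sum_add_distrib]
    exact Finset.sum_congr rfl fun i _ => by ring
  have h4 : ∑ i, lm (x + y) i ^ 2 = ∑ i, lm (x + y) i * lm (x + y) i :=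
    Finset.sum_congr rfl fun i _ => by ring
  rw [h4]
  linarith


/-- For the hyperbolicity cone `Λ` of a complete isometric hyperbolic
polynomial `p` of degree `d` along `e`: `dist_p(x,Λ) = inf {‖λ(x) - u‖₂ : u ∈ λ(Λ)}`;
and if moreover `λ(Λ) = ℝ^d₊ ∩ ℝ^d↓` then `dist_p(x,Λ)² = Σᵢ min(λᵢ(x),0)²`. -/
theorem stmt_3 {n d : ℕ}
    (P : MvPolynomial (Fin n) ℝ) (e : Fin n → ℝ)
    (lm : (Fin n → ℝ) → Fin d → ℝ)
    (hhom : P.IsHomogeneous d)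
    (hpe : MvPolynomial.eval e P ≠ 0)
    (hroots : ∀ (x : Fin n → ℝ) (t : ℝ),
      MvPolynomial.eval (x - t • e) P = MvPolynomial.eval e P * ∏ i, (lm x i - t))
    (hord : ∀ x, Antitone (lm x))
    (hcomplete : ∀ x, lm x = 0 → x = 0)
    (hiso : ∀ y z : Fin n → ℝ, ∃ x, lm x = lm z ∧ lm (x + y) = lm x + lm y)
    (x : Fin n → ℝ) :
    sInf {r : ℝ | ∃ y : Fin n → ℝ, (∀ i, 0 ≤ lm y i) ∧
        r = Real.sqrt (∑ i, lm (x - y) i ^ 2)}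
      = sInf {r : ℝ | ∃ u ∈ lm '' {y : Fin n → ℝ | ∀ i, 0 ≤ lm y i},
          r = Real.sqrt (∑ i, (lm x i - u i) ^ 2)} ∧
    (lm '' {y : Fin n → ℝ | ∀ i, 0 ≤ lm y i}
        = {u : Fin d → ℝ | (∀ i, 0 ≤ u i) ∧ Antitone u} →
      (sInf {r : ℝ | ∃ y : Fin n → ℝ, (∀ i, 0 ≤ lm y i) ∧
          r = Real.sqrt (∑ i, lm (x - y) i ^ 2)}) ^ 2
        = ∑ i, min (lm x i) 0 ^ 2) := by
  have hpar : ∀ a b : Fin n → ℝ, ∑ i, lm (a - b) i ^ 2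
      = 2 * ∑ i, lm a i ^ 2 + 2 * ∑ i, lm b i ^ 2 - ∑ i, lm (a + b) i ^ 2 := by
    intro a b
    obtain ⟨Q, hQ, hQ1, -⟩ := hyp_lift P e lm hhom hpe hroots
      (MvPolynomial.psum_isSymmetric (Fin d) ℝ 2) (N := 2) (by
        apply MvPolynomial.IsHomogeneous.sum
        intro i _
        exact MvPolynomial.isHomogeneous_X_pow i 2)
    have := hyp_deg2 hQ a b
    simpa [hQ1, MvPolynomial.psum] using this
  have hdiff : ∀ a b : Fin d → ℝ, ∑ i, (a i - b i) ^ 2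
      = 2 * ∑ i, a i ^ 2 + 2 * ∑ i, b i ^ 2 - ∑ i, (a i + b i) ^ 2 := by
    intro a b
    rw [Finset.mul_sum, Finset.mul_sum, ← Finset.sum_add_distrib, ← Finset.sum_sub_distrib]
    exact Finset.sum_congr rfl fun i _ => by ring
  have hlip : ∀ y, ∑ i, (lm x i - lm y i) ^ 2 ≤ ∑ i, lm (x - y) i ^ 2 := by
    intro y
    rw [hpar, hdiff]
    have := hyp_norm P e lm hhom hpe hroots hord x y
    linarith
  have hbelow : ∀ S : Set ℝ, (∀ r ∈ S, 0 ≤ r) → BddBelow S := fun S h => ⟨0, fun r hr => h r hr⟩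
  have hmain : sInf {r : ℝ | ∃ y : Fin n → ℝ, (∀ i, 0 ≤ lm y i) ∧
        r = Real.sqrt (∑ i, lm (x - y) i ^ 2)}
      = sInf {r : ℝ | ∃ u ∈ lm '' {y : Fin n → ℝ | ∀ i, 0 ≤ lm y i},
          r = Real.sqrt (∑ i, (lm x i - u i) ^ 2)} := by
    by_cases hne : ∃ y : Fin n → ℝ, ∀ i, 0 ≤ lm y i
    · obtain ⟨y0, hy0⟩ := hne
      apply le_antisymm
      · refine le_csInf ⟨_, lm y0, ⟨y0, hy0, rfl⟩, rfl⟩ ?_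
        rintro _ ⟨_, ⟨y, hy, rfl⟩, rfl⟩
        obtain ⟨x', hx1, hx2⟩ := hiso x y
        refine csInf_le (hbelow _ ?_) ⟨x', ?_, ?_⟩
        · rintro _ ⟨_, _, rfl⟩; exact Real.sqrt_nonneg _
        · rw [hx1]; exact hy
        · congr 1
          rw [hpar, hdiff, add_comm x x', hx2, hx1]
          congr 1
          exact Finset.sum_congr rfl fun i _ => by simp only [Pi.add_apply]; ring
      · refine le_csInf ⟨_, y0, hy0, rfl⟩ ?_
        rintro _ ⟨y, hy, rfl⟩
        refine le_trans (b := Real.sqrt (∑ i, (lm x i - lm y i) ^ 2)) ?_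
          (Real.sqrt_le_sqrt (hlip y))
        refine csInf_le (hbelow _ ?_) ⟨lm y, ⟨y, hy, rfl⟩, rfl⟩
        rintro _ ⟨_, _, rfl⟩; exact Real.sqrt_nonneg _
    · congr 1
      ext r
      constructor
      · rintro ⟨y, hy, _⟩; exact absurd ⟨y, hy⟩ hne
      · rintro ⟨_, ⟨y, hy, _⟩, _⟩; exact absurd ⟨y, hy⟩ hne
  refine ⟨hmain, fun hset => ?_⟩
  rw [hmain, hset]
  have hval : sInf {r : ℝ | ∃ u ∈ {u : Fin d → ℝ | (∀ i, 0 ≤ u i) ∧ Antitone u},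
      r = Real.sqrt (∑ i, (lm x i - u i) ^ 2)} = Real.sqrt (∑ i, min (lm x i) 0 ^ 2) := by
    apply IsLeast.csInf_eq
    constructor
    · refine ⟨fun i => max (lm x i) 0, ⟨fun i => le_max_right _ _, fun i j hij =>
        max_le_max_right 0 (hord x hij)⟩, ?_⟩
      congr 1
      refine Finset.sum_congr rfl fun i _ => ?_
      congr 1
      have := min_add_max (lm x i) 0
      linarith
    · rintro _ ⟨u, ⟨hu, _⟩, rfl⟩
      apply Real.sqrt_le_sqrt
      refine Finset.sum_le_sum fun i _ => ?_
      have := hu i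
      rcases le_total (lm x i) 0 with h | h
      · rw [min_eq_left h]; nlinarith
      · rw [min_eq_right h]; nlinarith [sq_nonneg (lm x i - u i)]
  rw [hval, Real.sq_sqrt (Finset.sum_nonneg fun i _ => sq_nonneg _)]
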